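/- (Step 1 of Theorem 1: Weak Planning Consistency forces posteriors to be Bayesian updates of priors.) Let S be a nonempty finite set, let C ⊆ Δ(S) be a nonempty compact convex set of priors, let A ⊆ S satisfy π(A) > 0 for every π ∈ C, and let D ⊆ Δ(S) be a nonempty compact convex set of priors with ν(A) = 1 for every ν ∈ D. Suppose that for every a : S → ℝ and every c ∈ ℝ, if min over π ∈ C of ( ∑_{s∈A} a(s)π(s) + c·π(S∖A) ) ≥ c, then min over ν ∈ D of E_ν[a] ≥ c. Then D ⊆ BU(C,A). -/

import Mathlib

open Finset

noncomputable section

/-- The set of priors (probability distributions) on a finite state space `S`. -/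
def simplex (S : Type*) [Fintype S] : Set (S → ℝ) :=
  {π | (∀ s, 0 ≤ π s) ∧ ∑ s, π s = 1}

variable {S : Type*} [Fintype S] [DecidableEq S]

/-- The probability of an event `A` under the prior `π`: `π(A) = ∑_{s ∈ A} π s`. -/
def pr (π : S → ℝ) (A : Finset S) : ℝ := ∑ s ∈ A, π s

/-- The Bayesian update `π_A` of a prior `π` given event `A`. -/
def bayes (π : S → ℝ) (A : Finset S) : S → ℝ :=
  fun s => if s ∈ A then π s / pr π A else 0

/-- Full bayesian posterior set: prior-by-prior Bayesian updating. -/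
def BU (C : Set (S → ℝ)) (A : Finset S) : Set (S → ℝ) :=
  (fun π => bayes π A) '' C

/-- `sup_{μ ∈ C} μ(A)`. -/
def maxPr (C : Set (S → ℝ)) (A : Finset S) : ℝ :=
  sSup ((fun μ => pr μ A) '' C)

/-- Partial bayesian posterior set with inference threshold `ρ`:
Bayesian updates of the priors `π ∈ C` with `π(A) ≥ ρ · sup_{μ ∈ C} μ(A)`. -/
def PB (C : Set (S → ℝ)) (A : Finset S) (ρ : ℝ) : Set (S → ℝ) :=
  (fun π => bayes π A) '' {π ∈ C | ρ * maxPr C A ≤ pr π A}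

/-- Expected value of `a : S → ℝ` under the prior `ν`. -/
def expv (a : S → ℝ) (ν : S → ℝ) : ℝ := ∑ s, a s * ν s

theorem pr_add_pr_compl (π : S → ℝ) (A : Finset S) : pr π A + pr π Aᶜ = ∑ s, π s :=
  Finset.sum_add_sum_compl A π

theorem continuous_pr {T : Type*} (A : Finset T) : Continuous fun π : T → ℝ => pr π A := by
  unfold pr
  fun_prop

theorem continuous_expv {T : Type*} [Fintype T] (a : T → ℝ) : Continuous (expv a) := by
  unfold expv
  fun_prop

theorem pr_linear_combination {T : Type*} (π₁ π₂ : T → ℝ) (x y : ℝ) (A : Finset T) :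
    pr (x • π₁ + y • π₂) A = x * pr π₁ A + y * pr π₂ A := by
  simp [pr, Finset.sum_add_distrib, Finset.mul_sum]

theorem exists_eq_expv (f : (S → ℝ) →L[ℝ] ℝ) : ∃ a : S → ℝ, ∀ ν, f ν = expv a ν := by
  refine ⟨fun s => f (Pi.single s 1), fun ν => ?_⟩
  rw [← ContinuousLinearMap.coe_coe, LinearMap.pi_apply_eq_sum_univ]
  refine Finset.sum_congr rfl fun s _ => ?_
  rw [smul_eq_mul, mul_comm]
  congr 2
  funext t
  simp [Pi.single_apply, eq_comm]

theorem pr_mul_expv_bayes (a π : S → ℝ) (A : Finset S) (h : pr π A ≠ 0) :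
    pr π A * expv a (bayes π A) = ∑ s ∈ A, a s * π s := by
  simp only [expv, bayes, mul_ite, mul_zero, Finset.sum_ite_mem, Finset.univ_inter,
    Finset.mul_sum]
  refine Finset.sum_congr rfl fun s _ => ?_
  field_simp

theorem isCompact_BU {T : Type*} [DecidableEq T] {C : Set (T → ℝ)} (hC : IsCompact C)
    {A : Finset T} (hA : ∀ π ∈ C, 0 < pr π A) : IsCompact (BU C A) := by
  refine hC.image_of_continuousOn (continuousOn_pi.2 fun s => ?_)
  by_cases hs : s ∈ A
  · simp only [bayes, hs, if_true]
    exact (continuous_apply s).continuousOn.div (continuous_pr A).continuousOn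
      fun π hπ => (hA π hπ).ne'
  · simp only [bayes, hs, if_false]
    exact continuousOn_const

theorem convex_BU {T : Type*} [DecidableEq T] {C : Set (T → ℝ)} (hC : Convex ℝ C)
    {A : Finset T} (hA : ∀ π ∈ C, 0 < pr π A) : Convex ℝ (BU C A) := by
  rintro _ ⟨π₁, h₁, rfl⟩ _ ⟨π₂, h₂, rfl⟩ x y hx hy hxy
  have hp₁ := hA π₁ h₁
  have hp₂ := hA π₂ h₂
  have hq : 0 < x * pr π₂ A + y * pr π₁ A := by
    rcases hx.eq_or_lt with rfl | hx'
    · have : y = 1 := by linarith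
      simpa [this] using hp₁
    · positivity
  refine ⟨(x * pr π₂ A / (x * pr π₂ A + y * pr π₁ A)) • π₁ +
    (y * pr π₁ A / (x * pr π₂ A + y * pr π₁ A)) • π₂,
    hC h₁ h₂ (by positivity) (by positivity) (by field_simp), ?_⟩
  have hpr : x * pr π₂ A / (x * pr π₂ A + y * pr π₁ A) * pr π₁ A +
      y * pr π₁ A / (x * pr π₂ A + y * pr π₁ A) * pr π₂ A =
      pr π₁ A * pr π₂ A / (x * pr π₂ A + y * pr π₁ A) := by
    field_simp
    exact hxy
  funext s
  by_cases hs : s ∈ A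
  · simp only [bayes, hs, if_true, pr_linear_combination, hpr, Pi.add_apply, Pi.smul_apply,
      smul_eq_mul]
    field_simp
  · simp [bayes, hs]

theorem stmt12 {S : Type*} [Fintype S] [DecidableEq S] [Nonempty S]
    (C : Set (S → ℝ)) (hCsub : C ⊆ simplex S) (hCne : C.Nonempty) (hCcomp : IsCompact C)
    (hCconv : Convex ℝ C)
    (A : Finset S) (hA : ∀ π ∈ C, 0 < pr π A)
    (D : Set (S → ℝ)) (hDsub : D ⊆ simplex S) (hDne : D.Nonempty) (hDcomp : IsCompact D)
    (hDconv : Convex ℝ D) (hDA : ∀ ν ∈ D, pr ν A = 1)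
    (hWPC : ∀ (a : S → ℝ) (c : ℝ),
      c ≤ sInf ((fun π => (∑ s ∈ A, a s * π s) + c * pr π Aᶜ) '' C) →
        c ≤ sInf (expv a '' D)) :
    D ⊆ BU C A := by
  intro ν hν
  by_contra hνBU
  obtain ⟨f, u, hfν, hfBU⟩ := geometric_hahn_banach_point_closed (convex_BU hCconv hA)
    (isCompact_BU hCcomp hA).isClosed hνBU
  obtain ⟨a, ha⟩ := exists_eq_expv f
  simp only [ha] at hfν hfBU
  refine absurd ((hWPC _ u (le_csInf (hCne.image _) ?_)).trans
    (csInf_le (hDcomp.image (continuous_expv _)).bddBelow ⟨ν, hν, rfl⟩)) hfν.not_ge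
  rintro _ ⟨π, hπ, rfl⟩
  have hp := hA π hπ
  have hsum := pr_add_pr_compl π A
  rw [(hCsub hπ).2] at hsum
  have hle := mul_le_mul_of_nonneg_left (hfBU _ ⟨π, hπ, rfl⟩).le hp.le
  rw [pr_mul_expv_bayes _ _ _ hp.ne'] at hle
  dsimp only
  calc u = pr π A * u + u * pr π Aᶜ := by linear_combination -u * hsum
    _ ≤ _ := by gcongr
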